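/- Let 0 < σ̲ ≤ 1 ≤ σ̄ < ∞, let 𝒟 ⊂ ℝ^d be a bounded set, and let ℝ^{d×d}_{σ̲,σ̄} denote the set of real d×d matrices all of whose singular values lie in [σ̲, σ̄]. Then the map T : (v, M) ↦ (MᵀM)⁻¹ det M, defined on ℝ^d × (invertible matrices) and restricted to 𝒟 × ℝ^{d×d}_{σ̲,σ̄}, is infinitely Fréchet differentiable and satisfies, for every r ∈ ℕ and every (v, M) ∈ 𝒟 × ℝ^{d×d}_{σ̲,σ̄}, the bound ‖D^r T(v, M)‖ ≤ r! k_T c_T^r with k_T = σ̲^{−2}(2σ̄)^d and c_T = 4(σ̲^{−2}σ̄² + 1), where ‖D^r T(v, M)‖ is the norm of D^r T(v,M) as an r-linear map from (ℝ^d × ℝ^{d×d})^r to ℝ^{d×d}. -/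

import Mathlib

open ContinuousLinearMap

section Bounds

set_option maxSynthPendingDepth 3

section Calculus

variable {D E F G : Type*} [NormedAddCommGroup D] [NormedSpace ℝ D]
  [NormedAddCommGroup E] [NormedSpace ℝ E] [NormedAddCommGroup F] [NormedSpace ℝ F]
  [NormedAddCommGroup G] [NormedSpace ℝ G]

/-- Leibniz bound for a bilinear map of norm at most one, on an open set, given factorial bounds
for the derivatives of the two factors. -/
lemma norm_iteratedFDeriv_bilinear_le_factorial_mul_sum (B : E →L[ℝ] F →L[ℝ] G) (hB : ‖B‖ ≤ 1)
    {f : D → E} {g : D → F} {s : Set D} (hs : IsOpen s) {n : ℕ}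
    (hf : ContDiffOn ℝ n f s) (hg : ContDiffOn ℝ n g s) {x : D} (hx : x ∈ s) (a b : ℕ → ℝ)
    (ha : ∀ k ≤ n, ‖iteratedFDeriv ℝ k f x‖ ≤ k.factorial * a k)
    (hb : ∀ k ≤ n, ‖iteratedFDeriv ℝ k g x‖ ≤ k.factorial * b k) :
    ‖iteratedFDeriv ℝ n (fun y => B (f y) (g y)) x‖ ≤
      n.factorial * ∑ k ∈ Finset.range (n + 1), a k * b (n - k) := by
  have h := B.norm_iteratedFDerivWithin_le_of_bilinear_of_le_one hf hg hs.uniqueDiffOn hx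
    le_rfl hB
  simp only [iteratedFDerivWithin_of_isOpen _ hs hx] at h
  refine h.trans ?_
  rw [Finset.mul_sum]
  refine Finset.sum_le_sum fun k hk => ?_
  have hk : k ≤ n := Finset.mem_range_succ_iff.mp hk
  have h₁ := ha k hk
  calc (n.choose k : ℝ) * ‖iteratedFDeriv ℝ k f x‖ * ‖iteratedFDeriv ℝ (n - k) g x‖
      ≤ n.choose k * (k.factorial * a k) * ((n - k).factorial * b (n - k)) := by
        gcongr
        · exact mul_nonneg (by positivity) ((norm_nonneg _).trans h₁)
        · exact hb _ (Nat.sub_le n k)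
    _ = n.factorial * (a k * b (n - k)) := by
        rw [← Nat.choose_mul_factorial_mul_factorial hk]
        push_cast
        ring

lemma norm_iteratedFDeriv_comp_right_le (L : D →L[ℝ] E) (hL : ‖L‖ ≤ 1) {f : E → F} {s : Set E}
    (hs : IsOpen s) {n : ℕ} (hf : ContDiffOn ℝ n f s) {x : D} (hx : L x ∈ s) :
    ‖iteratedFDeriv ℝ n (fun y => f (L y)) x‖ ≤ ‖iteratedFDeriv ℝ n f (L x)‖ := by
  have hs' : IsOpen (L ⁻¹' s) := hs.preimage L.continuous
  have h := L.iteratedFDerivWithin_comp_right hf hs.uniqueDiffOn hs'.uniqueDiffOn hx le_rfl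
  rw [iteratedFDerivWithin_of_isOpen _ hs' hx, iteratedFDerivWithin_of_isOpen _ hs hx] at h
  change ‖iteratedFDeriv ℝ n (f ∘ L) x‖ ≤ _
  rw [h]
  refine (ContinuousMultilinearMap.norm_compContinuousLinearMap_le _ _).trans ?_
  refine mul_le_of_le_one_right (norm_nonneg _) ?_
  exact Finset.prod_le_one (fun _ _ => norm_nonneg _) fun _ _ => hL

end Calculus

lemma sum_pow_succ_mul_pow_succ (a : ℝ) (n : ℕ) :
    ∑ k ∈ Finset.range (n + 1), a ^ (k + 1) * a ^ (n - k + 1) = (n + 1) * a ^ (n + 2) := by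
  rw [Finset.sum_congr rfl (g := fun _ => a ^ (n + 2))]
  · simp
  · intro k hk
    have := Finset.mem_range_succ_iff.mp hk
    rw [← pow_add]
    congr 1
    lia

section Inverse

variable {R : Type*} [NormedRing R] [NormedAlgebra ℝ R] [CompleteSpace R]

lemma contDiffOn_ringInverse (n : WithTop ℕ∞) :
    ContDiffOn ℝ n (Ring.inverse : R → R) {x | IsUnit x} := by
  rintro x ⟨u, rfl⟩
  exact (contDiffAt_ringInverse ℝ u).contDiffWithinAt

lemma norm_iteratedFDeriv_ringInverse_le {x : R} (hx : IsUnit x) {a : ℝ}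
    (ha : ‖Ring.inverse x‖ ≤ a) (n : ℕ) :
    ‖iteratedFDeriv ℝ n (Ring.inverse : R → R) x‖ ≤ n.factorial * a ^ (n + 1) := by
  induction n using Nat.strong_induction_on with
  | _ n ih =>
    cases n with
    | zero => simpa using ha
    | succ n =>
      have hs : IsOpen {x : R | IsUnit x} := Units.isOpen
      have hfd : fderiv ℝ (Ring.inverse : R → R) =ᶠ[nhds x]
          fun y => (-mulLeftRight ℝ R) (Ring.inverse y) (Ring.inverse y) := by
        filter_upwards [hs.mem_nhds hx] with y hy
        obtain ⟨u, rfl⟩ := hy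
        rw [fderiv_inverse, Ring.inverse_unit]
        rfl
      rw [← norm_iteratedFDeriv_fderiv, (hfd.iteratedFDeriv ℝ n).eq_of_nhds]
      have hB : ‖-mulLeftRight ℝ R‖ ≤ 1 := by
        rw [norm_neg]
        exact opNorm_mulLeftRight_le ℝ R
      refine (norm_iteratedFDeriv_bilinear_le_factorial_mul_sum _ hB hs
        (contDiffOn_ringInverse _) (contDiffOn_ringInverse _) hx
        (fun k => a ^ (k + 1)) (fun k => a ^ (k + 1))
        (fun k hk => ih k (by lia)) (fun k hk => ih k (by lia))).trans_eq ?_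
      rw [sum_pow_succ_mul_pow_succ, Nat.factorial_succ]
      push_cast
      ring

end Inverse

section Euclidean

variable {d : ℕ}

/-- The determinant as a continuous multilinear function of the columns. -/
noncomputable def columnDet (d : ℕ) :
    ContinuousMultilinearMap ℝ (fun _ : Fin d => EuclideanSpace ℝ (Fin d)) ℝ :=
  MultilinearMap.mkContinuous
    (EuclideanSpace.basisFun (Fin d) ℝ).toBasis.det.toMultilinearMap 1 fun v => by
      have : Fact (Module.finrank ℝ (EuclideanSpace ℝ (Fin d)) = d) := ⟨by simp⟩
      let b := EuclideanSpace.basisFun (Fin d) ℝ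
      have h := b.toBasis.orientation.abs_volumeForm_apply_le v
      rw [b.toBasis.orientation.volumeForm_robust' b] at h
      rw [one_mul]
      exact h

lemma norm_columnDet_le : ‖columnDet d‖ ≤ 1 :=
  MultilinearMap.mkContinuous_norm_le _ zero_le_one _

/-- The columns of a continuous endomorphism of Euclidean space. -/
noncomputable def columns (d : ℕ) :
    (EuclideanSpace ℝ (Fin d) →L[ℝ] EuclideanSpace ℝ (Fin d)) →L[ℝ]
      (Fin d → EuclideanSpace ℝ (Fin d)) :=
  ContinuousLinearMap.pi fun i =>
    ContinuousLinearMap.apply ℝ _ (EuclideanSpace.basisFun (Fin d) ℝ i)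

lemma norm_columns_apply_le (M : EuclideanSpace ℝ (Fin d) →L[ℝ] EuclideanSpace ℝ (Fin d)) :
    ‖columns d M‖ ≤ ‖M‖ := by
  refine (pi_norm_le_iff_of_nonneg (norm_nonneg _)).mpr fun i => ?_
  exact M.unit_le_opNorm _ ((EuclideanSpace.basisFun (Fin d) ℝ).orthonormal.1 i).le

lemma norm_columns_le : ‖columns d‖ ≤ 1 :=
  opNorm_le_bound _ zero_le_one fun M => by simpa using norm_columns_apply_le M

lemma det_eq_columnDet_columns (M : EuclideanSpace ℝ (Fin d) →L[ℝ] EuclideanSpace ℝ (Fin d)) :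
    LinearMap.det (M : EuclideanSpace ℝ (Fin d) →ₗ[ℝ] EuclideanSpace ℝ (Fin d)) =
      columnDet d (columns d M) := by
  have h := (EuclideanSpace.basisFun (Fin d) ℝ).toBasis.det_comp
    (M : EuclideanSpace ℝ (Fin d) →ₗ[ℝ] EuclideanSpace ℝ (Fin d))
    (EuclideanSpace.basisFun (Fin d) ℝ).toBasis
  rw [Module.Basis.det_self, mul_one] at h
  rw [← h]
  change _ = (EuclideanSpace.basisFun (Fin d) ℝ).toBasis.det (columns d M)
  congr 1

lemma contDiff_det (n : WithTop ℕ∞) :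
    ContDiff ℝ n fun M : EuclideanSpace ℝ (Fin d) →L[ℝ] EuclideanSpace ℝ (Fin d) =>
      LinearMap.det (M : EuclideanSpace ℝ (Fin d) →ₗ[ℝ] EuclideanSpace ℝ (Fin d)) := by
  simp only [det_eq_columnDet_columns]
  exact (columnDet d).contDiff.comp (columns d).contDiff

lemma norm_iteratedFDeriv_det_le {M : EuclideanSpace ℝ (Fin d) →L[ℝ] EuclideanSpace ℝ (Fin d)}
    {b : ℝ} (hb : 1 ≤ b) (hM : ‖M‖ ≤ b) (n : ℕ) :
    ‖iteratedFDeriv ℝ n (fun M : EuclideanSpace ℝ (Fin d) →L[ℝ] EuclideanSpace ℝ (Fin d) =>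
      LinearMap.det (M : EuclideanSpace ℝ (Fin d) →ₗ[ℝ] EuclideanSpace ℝ (Fin d))) M‖ ≤
      n.factorial * (2 * b) ^ d := by
  simp only [det_eq_columnDet_columns]
  refine (norm_iteratedFDeriv_comp_right_le (columns d) norm_columns_le isOpen_univ
    (columnDet d).contDiff.contDiffOn (Set.mem_univ _)).trans ?_
  refine ((columnDet d).norm_iteratedFDeriv_le n _).trans ?_
  rw [Fintype.card_fin, Nat.descFactorial_eq_factorial_mul_choose, mul_pow]
  have hchoose : (d.choose n : ℝ) ≤ 2 ^ d := by exact_mod_cast Nat.choose_le_two_pow d n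
  have hpow : ‖columns d M‖ ^ (d - n) ≤ b ^ d :=
    (pow_le_pow_left₀ (norm_nonneg _) ((norm_columns_apply_le M).trans hM) _).trans
      (pow_le_pow_right₀ hb (Nat.sub_le d n))
  push_cast
  calc (n.factorial * d.choose n : ℝ) * ‖columnDet d‖ * ‖columns d M‖ ^ (d - n)
      ≤ (n.factorial * 2 ^ d) * 1 * b ^ d := by
        gcongr
        exact norm_columnDet_le
    _ = n.factorial * (2 ^ d * b ^ d) := by ring

end Euclidean

section Adjoint

variable {E : Type*} [NormedAddCommGroup E] [InnerProductSpace ℝ E] [CompleteSpace E]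

/-- The bilinear map `(A, B) ↦ A * Bᵀ`. -/
noncomputable def mulAdjoint (E : Type*) [NormedAddCommGroup E] [InnerProductSpace ℝ E]
    [CompleteSpace E] : (E →L[ℝ] E) →L[ℝ] (E →L[ℝ] E) →L[ℝ] (E →L[ℝ] E) :=
  LinearMap.mkContinuous₂
    (LinearMap.mk₂ ℝ (fun A B => A * adjoint B) (by intros; simp [add_mul]) (by intros; simp)
      (by intros; simp [mul_add]) (by intros; simp)) 1 fun A B => by
    simpa using norm_mul_le A (adjoint B)

lemma norm_mulAdjoint_le : ‖mulAdjoint E‖ ≤ 1 :=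
  LinearMap.mkContinuous₂_norm_le _ zero_le_one _

lemma ringInverse_adjoint_mul_self {M : E →L[ℝ] E} (hM : IsUnit M) :
    Ring.inverse (adjoint M * M) = mulAdjoint E (Ring.inverse M) (Ring.inverse M) := by
  change Ring.inverse (star M * M) = Ring.inverse M * star (Ring.inverse M)
  obtain ⟨u, rfl⟩ := hM
  rw [← Units.coe_star, ← Units.val_mul, Ring.inverse_unit, Ring.inverse_unit, mul_inv_rev]
  simp only [Units.val_mul, ← Units.coe_star, star_inv]

lemma contDiffOn_mulAdjoint_ringInverse (n : WithTop ℕ∞) :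
    ContDiffOn ℝ n (fun M : E →L[ℝ] E => mulAdjoint E (Ring.inverse M) (Ring.inverse M))
      {M | IsUnit M} :=
  ((mulAdjoint E).contDiff.comp_contDiffOn (contDiffOn_ringInverse n)).clm_apply
    (contDiffOn_ringInverse n)

lemma norm_iteratedFDeriv_ringInverse_adjoint_mul_self_le {M : E →L[ℝ] E} (hM : IsUnit M) {a : ℝ}
    (ha : ‖Ring.inverse M‖ ≤ a) (n : ℕ) :
    ‖iteratedFDeriv ℝ n
      (fun M : E →L[ℝ] E => mulAdjoint E (Ring.inverse M) (Ring.inverse M)) M‖ ≤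
      n.factorial * ((n + 1) * a ^ (n + 2)) := by
  refine (norm_iteratedFDeriv_bilinear_le_factorial_mul_sum _ norm_mulAdjoint_le Units.isOpen
    (contDiffOn_ringInverse _) (contDiffOn_ringInverse _) hM
    (fun k => a ^ (k + 1)) (fun k => a ^ (k + 1))
    (fun k _ => norm_iteratedFDeriv_ringInverse_le hM ha k)
    (fun k _ => norm_iteratedFDeriv_ringInverse_le hM ha k)).trans_eq ?_
  rw [sum_pow_succ_mul_pow_succ]

lemma isUnit_of_mul_norm_le [FiniteDimensional ℝ E] {M : E →L[ℝ] E} {c : ℝ} (hc : 0 < c)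
    (h : ∀ x, c * ‖x‖ ≤ ‖M x‖) : IsUnit M := by
  rw [isUnit_iff_isUnit_toLinearMap, LinearMap.isUnit_iff_ker_eq_bot, LinearMap.ker_eq_bot']
  intro x hx
  have h' := h x
  rw [show M x = 0 from hx, norm_zero] at h'
  exact norm_le_zero_iff.mp (nonpos_of_mul_nonpos_right h' hc)

end Adjoint

lemma norm_ringInverse_le_of_mul_norm_le {E : Type*} [NormedAddCommGroup E]
    [NormedSpace ℝ E] {M : E →L[ℝ] E} (hM : IsUnit M) {c : ℝ} (hc : 0 < c)
    (h : ∀ x, c * ‖x‖ ≤ ‖M x‖) : ‖Ring.inverse M‖ ≤ c⁻¹ := by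
  refine opNorm_le_bound _ (inv_nonneg.mpr hc.le) fun x => ?_
  have h' := h (Ring.inverse M x)
  have hx : M (Ring.inverse M x) = x := DFunLike.congr_fun (Ring.mul_inverse_cancel M hM) x
  rw [hx] at h'
  rwa [inv_mul_eq_div, le_div_iff₀' hc]

lemma sum_add_one_mul_pow_le {a t c : ℝ} (ha : 1 ≤ a) (ht : 0 ≤ t) (hc : 4 * a ≤ c) (n : ℕ) :
    ∑ k ∈ Finset.range (n + 1), t * ((((n - k : ℕ) : ℝ) + 1) * a ^ (n - k + 2)) ≤
      a ^ 2 * t * c ^ n := by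
  have hn : (n + 1 : ℝ) ≤ 2 ^ n := by exact_mod_cast Nat.lt_two_pow_self
  calc ∑ k ∈ Finset.range (n + 1), t * ((((n - k : ℕ) : ℝ) + 1) * a ^ (n - k + 2))
      ≤ ∑ k ∈ Finset.range (n + 1), t * ((n + 1) * a ^ (n + 2)) := by
        gcongr <;> first | exact ha | lia
    _ = t * a ^ (n + 2) * ((n + 1) * (n + 1)) := by
        simp
        ring
    _ ≤ t * a ^ (n + 2) * (2 ^ n * 2 ^ n) := by gcongr
    _ = a ^ 2 * t * (4 * a) ^ n := by
        rw [← mul_pow, mul_pow 4]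
        norm_num
        ring
    _ ≤ a ^ 2 * t * c ^ n := by gcongr

lemma norm_iteratedFDeriv_det_smul_le {d : ℕ} {σl σu : ℝ} (hσl : 0 < σl) (hσl1 : σl ≤ 1)
    (hσu : 1 ≤ σu) {M : EuclideanSpace ℝ (Fin d) →L[ℝ] EuclideanSpace ℝ (Fin d)}
    (hM : ∀ x, σl * ‖x‖ ≤ ‖M x‖ ∧ ‖M x‖ ≤ σu * ‖x‖) (r : ℕ) :
    ‖iteratedFDeriv ℝ r (fun M : EuclideanSpace ℝ (Fin d) →L[ℝ] EuclideanSpace ℝ (Fin d) =>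
      LinearMap.det (M : EuclideanSpace ℝ (Fin d) →ₗ[ℝ] EuclideanSpace ℝ (Fin d)) •
        mulAdjoint (EuclideanSpace ℝ (Fin d)) (Ring.inverse M) (Ring.inverse M)) M‖ ≤
      (r.factorial : ℝ) * ((σl ^ 2)⁻¹ * (2 * σu) ^ d) * (4 * ((σl ^ 2)⁻¹ * σu ^ 2 + 1)) ^ r := by
  have hunit : IsUnit M := isUnit_of_mul_norm_le hσl fun x => (hM x).1
  have hM_norm : ‖M‖ ≤ σu := opNorm_le_bound _ (zero_le_one.trans hσu) fun x => (hM x).2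
  have hM_inv : ‖Ring.inverse M‖ ≤ σl⁻¹ :=
    norm_ringInverse_le_of_mul_norm_le hunit hσl fun x => (hM x).1
  have hl : 1 ≤ σl⁻¹ := (one_le_inv₀ hσl).mpr hσl1
  rw [← inv_pow]
  have hc : 4 * σl⁻¹ ≤ 4 * (σl⁻¹ ^ 2 * σu ^ 2 + 1) := by
    rw [← mul_pow]
    nlinarith [mul_le_mul_of_nonneg_left hσu (zero_le_one.trans hl), sq_nonneg (σl⁻¹ * σu - 1)]
  refine (norm_iteratedFDeriv_bilinear_le_factorial_mul_sum (ContinuousLinearMap.lsmul ℝ ℝ)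
    opNorm_lsmul_le Units.isOpen (contDiff_det r).contDiffOn
    (contDiffOn_mulAdjoint_ringInverse r) hunit (fun _ => (2 * σu) ^ d)
    (fun k => (k + 1) * σl⁻¹ ^ (k + 2)) (fun k _ => norm_iteratedFDeriv_det_le hσu hM_norm k)
    (fun k _ => norm_iteratedFDeriv_ringInverse_adjoint_mul_self_le hunit hM_inv k)).trans ?_
  rw [mul_assoc (r.factorial : ℝ)]
  exact mul_le_mul_of_nonneg_left (sum_add_one_mul_pow_le hl (by positivity) hc r)
    (Nat.cast_nonneg _)

end Bounds

/-- Let `0 < σ̲ ≤ 1 ≤ σ̄`, `𝒟 ⊆ ℝ^d` bounded, and let `S` be the set of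
real `d×d` matrices (continuous linear endomorphisms of Euclidean space, so the operator
norm is the spectral norm) all of whose singular values lie in `[σ̲, σ̄]`, i.e.
`σ̲‖x‖ ≤ ‖Mx‖ ≤ σ̄‖x‖` for all `x`.  Then `T : (v, M) ↦ (MᵀM)⁻¹ det M` is infinitely
Fréchet differentiable on `𝒟 × S` and `‖D^r T(v,M)‖ ≤ r! k_T c_T^r` there, with
`k_T = σ̲⁻²(2σ̄)^d` and `c_T = 4(σ̲⁻²σ̄² + 1)`. -/
theorem stmt6 (d : ℕ) (σl σu : ℝ) (hσl : 0 < σl) (hσl1 : σl ≤ 1) (hσu : 1 ≤ σu)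
    (𝒟 : Set (EuclideanSpace ℝ (Fin d))) (h𝒟 : Bornology.IsBounded 𝒟) :
    ContDiffOn ℝ (⊤ : ℕ∞)
      (fun p : EuclideanSpace ℝ (Fin d) ×
          (EuclideanSpace ℝ (Fin d) →L[ℝ] EuclideanSpace ℝ (Fin d)) =>
        LinearMap.det (p.2 : EuclideanSpace ℝ (Fin d) →ₗ[ℝ] EuclideanSpace ℝ (Fin d)) •
          Ring.inverse (adjoint p.2 * p.2))
      (𝒟 ×ˢ {M : EuclideanSpace ℝ (Fin d) →L[ℝ] EuclideanSpace ℝ (Fin d) |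
        ∀ x, σl * ‖x‖ ≤ ‖M x‖ ∧ ‖M x‖ ≤ σu * ‖x‖}) ∧
    ∀ r : ℕ, ∀ v ∈ 𝒟,
      ∀ M : EuclideanSpace ℝ (Fin d) →L[ℝ] EuclideanSpace ℝ (Fin d),
        (∀ x, σl * ‖x‖ ≤ ‖M x‖ ∧ ‖M x‖ ≤ σu * ‖x‖) →
        ‖iteratedFDeriv ℝ r
            (fun p : EuclideanSpace ℝ (Fin d) ×
                (EuclideanSpace ℝ (Fin d) →L[ℝ] EuclideanSpace ℝ (Fin d)) =>
              LinearMap.det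
                  (p.2 : EuclideanSpace ℝ (Fin d) →ₗ[ℝ] EuclideanSpace ℝ (Fin d)) •
                Ring.inverse (adjoint p.2 * p.2)) (v, M)‖ ≤
          (r.factorial : ℝ) * ((σl ^ 2)⁻¹ * (2 * σu) ^ d) *
            (4 * ((σl ^ 2)⁻¹ * σu ^ 2 + 1)) ^ r := by
  have hunit : ∀ M : EuclideanSpace ℝ (Fin d) →L[ℝ] EuclideanSpace ℝ (Fin d),
      (∀ x, σl * ‖x‖ ≤ ‖M x‖ ∧ ‖M x‖ ≤ σu * ‖x‖) → IsUnit M :=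
    fun M hM => isUnit_of_mul_norm_le hσl fun x => (hM x).1
  let s : Set (EuclideanSpace ℝ (Fin d) →L[ℝ] EuclideanSpace ℝ (Fin d)) := {M | IsUnit M}
  have hs : IsOpen s := Units.isOpen
  let F := fun M : EuclideanSpace ℝ (Fin d) →L[ℝ] EuclideanSpace ℝ (Fin d) =>
    LinearMap.det (M : EuclideanSpace ℝ (Fin d) →ₗ[ℝ] EuclideanSpace ℝ (Fin d)) •
      mulAdjoint (EuclideanSpace ℝ (Fin d)) (Ring.inverse M) (Ring.inverse M)
  have hF : ∀ n, ContDiffOn ℝ n F s := fun n =>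
    (contDiff_det n).contDiffOn.smul (contDiffOn_mulAdjoint_ringInverse n)
  refine ⟨?_, fun r v _ M hM => ?_⟩
  · refine ((hF _).comp contDiff_snd.contDiffOn fun p hp => hunit p.2 hp.2).congr fun p hp => ?_
    simp only [ringInverse_adjoint_mul_self (hunit p.2 hp.2)]
    rfl
  · have hMs : M ∈ s := hunit M hM
    have heq : (fun p : EuclideanSpace ℝ (Fin d) ×
        (EuclideanSpace ℝ (Fin d) →L[ℝ] EuclideanSpace ℝ (Fin d)) =>
          LinearMap.det (p.2 : EuclideanSpace ℝ (Fin d) →ₗ[ℝ] EuclideanSpace ℝ (Fin d)) •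
            Ring.inverse (adjoint p.2 * p.2)) =ᶠ[nhds (v, M)]
        fun p => F (ContinuousLinearMap.snd ℝ _ _ p) := by
      filter_upwards [continuous_snd.continuousAt.preimage_mem_nhds (hs.mem_nhds hMs)] with p hp
      simp only [ringInverse_adjoint_mul_self hp]
      rfl
    rw [(heq.iteratedFDeriv ℝ r).eq_of_nhds]
    have hcomp := norm_iteratedFDeriv_comp_right_le (ContinuousLinearMap.snd ℝ
      (EuclideanSpace ℝ (Fin d)) (EuclideanSpace ℝ (Fin d) →L[ℝ] EuclideanSpace ℝ (Fin d)))
      (norm_snd_le ℝ _ _) hs (hF r) (x := (v, M)) hMs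
    exact hcomp.trans (norm_iteratedFDeriv_det_smul_le hσl hσl1 hσu hM r)
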